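/- arXiv:math/0302232 — 2 statements merged into one kernel-verified Lean document; each statement's English description precedes it below -/
import Mathlib

section
/- Let λ₀ ∈ 𝔞*(P,R) ∩ E and let ω ⊂ 𝔞*(P,R) ∩ E be a compact neighborhood of λ₀ in E. Let M > 0 and N ∈ ℕ. Then there exist n ∈ ℕ and C > 0 such that |φ(λ)| ≤ C (1+|λ|)^{-N} e^{M|Re λ|} ν_{ω,n}(φ) for all λ ∈ λ₀ + ā*(P,0) and all φ ∈ 𝒬_M(R). -/
noncomputable section

open Complex Real

/-- ℂ^d with the Euclidean norm. -/
abbrev Cd (d : ℕ) := EuclideanSpace ℂ (Fin d)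
/-- ℝ^d with the Euclidean norm. -/
abbrev Ed (d : ℕ) := EuclideanSpace ℝ (Fin d)

/-- Componentwise real part. -/
def rePart (d : ℕ) (l : Cd d) : Ed d := WithLp.toLp 2 fun j => (l j).re

/-- Inclusion of ℝ^d into ℂ^d. -/
def toC (d : ℕ) (x : Ed d) : Cd d := WithLp.toLp 2 fun j => (x j : ℂ)

/-- The tube 𝔞*(P,R). -/
def aStar (d : ℕ) (Sp : Finset (Ed d)) (R : ℝ) : Set (Cd d) :=
  {l | ∀ α ∈ Sp, (∑ j, (l j).re * α j) < R}

/-- The seminorm ν_{ω,n}. -/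
def nu (d : ℕ) (ω : Set (Ed d)) (n : ℕ) (φ : Cd d → ℂ) : ℝ :=
  sSup {r : ℝ | ∃ l : Cd d, rePart d l ∈ ω ∧ r = (1 + ‖l‖) ^ n * ‖φ l‖}

/-- Membership in 𝒬(R). -/
def memQ (d : ℕ) (Sp : Finset (Ed d)) (R : ℝ) (φ : Cd d → ℂ) : Prop :=
  DifferentiableOn ℂ φ (aStar d Sp R) ∧
  ∀ (n : ℕ) (ω : Set (Ed d)), Bornology.IsBounded ω → toC d '' ω ⊆ aStar d Sp R →
    ∃ C : ℝ, ∀ l : Cd d, rePart d l ∈ ω → (1 + ‖l‖) ^ n * ‖φ l‖ ≤ C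

/-- Strictly antidominant. -/
def Antidom (d : ℕ) (Sp : Finset (Ed d)) (η : Ed d) : Prop :=
  ∀ α ∈ Sp, (∑ j, η j * α j) < 0

/-- Membership in 𝒬_M(R). -/
def memQM (d : ℕ) (Sp : Finset (Ed d)) (R M : ℝ) (φ : Cd d → ℂ) : Prop :=
  memQ d Sp R φ ∧
  ∀ η : Ed d, Antidom d Sp η →
    ∃ tη Cη : ℝ, 0 < tη ∧ 0 < Cη ∧
      ∀ t : ℝ, tη ≤ t → ∀ l : Cd d, rePart d l = t • η →
        ‖φ l‖ ≤
          Cη * (1 + ‖l‖) ^ (-(d : ℝ) - 1) * Real.exp (M * ‖rePart d l‖)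

lemma aStar_isOpen (d : ℕ) (Sp : Finset (Ed d)) (R : ℝ) : IsOpen (aStar d Sp R) := by
  have : aStar d Sp R = ⋂ α ∈ Sp, {l : Cd d | (∑ j, (l j).re * α j) < R} := by
    ext l; simp [aStar]
  rw [this]
  refine isOpen_biInter_finset fun α _ => isOpen_lt ?_ continuous_const
  fun_prop

lemma core1 (d : ℕ) (Sp : Finset (Ed d)) (R M : ℝ) (φ : Cd d → ℂ) (hφ : memQ d Sp R φ)
    (x η : Ed d) (hx : toC d x ∈ aStar d Sp R) (T Cη : ℝ) (hT : 1 ≤ T)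
    (hCη : 0 < Cη)
    (hTη : toC d (T • η) ∈ aStar d Sp R)
    (hb : ∀ l : Cd d, rePart d l = T • η → ‖φ l‖ ≤ Cη * Real.exp (M * (T * ‖η‖)))
    (N : ℕ) (B : ℝ)
    (hB : ∀ l : Cd d, rePart d l = x → (1 + ‖l‖) ^ N * ‖φ l‖ ≤ B)
    (j : Fin d) (σ : ℝ) (hσ : |σ| = 1) (hση : 0 ≤ σ * η j) (δ : ℝ) (hδ : 0 < δ)
    (P : Cd d) (hP : rePart d P = x) (L : Cd d)
    (hL : L = P + (T⁻¹ : ℂ) • toC d (T • η - x)) :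
    ‖φ L * (((1 + |x j| : ℝ) + σ * L j) / (1 + δ * ((1 + |x j| : ℝ) + σ * L j))) ^ N‖ ≤
      ((1 + |x j|) ^ N * B) ^ (1 - T⁻¹) *
        ((δ⁻¹ ^ N * Cη) ^ (T⁻¹) * Real.exp (M * ‖η‖)) := by
  have hPre : ∀ i, (P i).re = x i := fun i => by rw [← hP]; rfl
  have hT0 : 0 < T := by linarith
  set V : Cd d := toC d (T • η - x) with hV
  have hVi : ∀ i, V i = ((T * η i - x i : ℝ) : ℂ) := fun i => by simp [hV, toC]
  set G : Cd d → ℂ := fun l =>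
    φ l * (((1 + |x j| : ℝ) + σ * l j) / (1 + δ * ((1 + |x j| : ℝ) + σ * l j))) ^ N with hG
  have hre : ∀ z : ℂ, ∀ i, ((P + z • V) i).re = (1 - z.re) * x i + z.re * (T * η i) := by
    intro z i
    simp [hVi, hPre]; ring
  have hreP : ∀ z : ℂ, rePart d (P + z • V) = (1 - z.re) • x + z.re • (T • η) := by
    intro z; ext i
    have := hre z i
    simpa [rePart] using this
  have hseg : ∀ s : ℝ, 0 ≤ s → s ≤ 1 → ∀ α ∈ Sp,
      ∑ i, ((1 - s) * x i + s * (T * η i)) * α i < R := by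
    intro s h0 h1 α hα
    have a1 := hx α hα
    have a2 := hTη α hα
    simp only [toC, Complex.ofReal_re, PiLp.smul_apply, smul_eq_mul] at a1 a2
    have : ∑ i, ((1 - s) * x i + s * (T * η i)) * α i =
        (1 - s) * ∑ i, x i * α i + s * ∑ i, (T * η i) * α i := by
      rw [Finset.mul_sum, Finset.mul_sum, ← Finset.sum_add_distrib]
      exact Finset.sum_congr rfl fun i _ => by ring
    rw [this]
    rcases eq_or_lt_of_le h0 with h | h
    · subst h; simpa using a1
    · nlinarith
  have hmem : ∀ z : ℂ, 0 ≤ z.re → z.re ≤ 1 → P + z • V ∈ aStar d Sp R := by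
    intro z h0 h1 α hα
    simp only [hre]
    exact hseg _ h0 h1 α hα
  have hσx : -|x j| ≤ σ * x j := by
    have := neg_abs_le (σ * x j)
    rwa [abs_mul, hσ, one_mul] at this
  have hell : ∀ z : ℂ, 0 ≤ z.re → z.re ≤ 1 →
      1 ≤ (((1 + |x j| : ℝ) : ℂ) + σ * (P + z • V) j).re := by
    intro z h0 h1
    rw [Complex.add_re, Complex.re_ofReal_mul, hre, Complex.ofReal_re]
    have : 0 ≤ z.re * T * (σ * η j) := by positivity
    have h3 : (1 - z.re) * (-|x j|) ≤ (1 - z.re) * (σ * x j) :=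
      mul_le_mul_of_nonneg_left hσx (by linarith)
    have := abs_nonneg (x j)
    nlinarith
  have hden : ∀ w : ℂ, 1 ≤ w.re → 1 ≤ ‖1 + δ * w‖ := by
    intro w hw
    refine le_trans ?_ (Complex.re_le_norm _)
    rw [Complex.add_re, Complex.re_ofReal_mul, Complex.one_re]
    nlinarith
  have hden2 : ∀ w : ℂ, 1 ≤ w.re → δ * ‖w‖ ≤ ‖1 + δ * w‖ := by
    intro w hw
    have : δ * ‖w‖ = ‖(δ * w : ℂ)‖ := by simp [abs_of_pos hδ]
    rw [this]
    rw [← sq_le_sq₀ (norm_nonneg _) (norm_nonneg _), ← Complex.normSq_eq_norm_sq,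
      ← Complex.normSq_eq_norm_sq, Complex.normSq_apply, Complex.normSq_apply]
    simp
    nlinarith
  have hq1 : ∀ w : ℂ, 1 ≤ w.re → ‖(w / (1 + δ * w)) ^ N‖ ≤ ‖w‖ ^ N := by
    intro w hw
    rw [norm_pow, norm_div]
    gcongr
    exact div_le_self (norm_nonneg _) (hden w hw)
  have hq2 : ∀ w : ℂ, 1 ≤ w.re → ‖(w / (1 + δ * w)) ^ N‖ ≤ δ⁻¹ ^ N := by
    intro w hw
    rw [norm_pow, norm_div]
    gcongr
    rw [div_le_iff₀ (by linarith [hden w hw]), inv_mul_eq_div, le_div_iff₀ hδ]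
    linarith [hden2 w hw]
  obtain ⟨K, hK⟩ := hφ.2 0 (segment ℝ x (T • η)) (by
      rw [segment_eq_image]
      exact (isCompact_Icc.image (by fun_prop)).isBounded) (by
      rintro _ ⟨y, hy, rfl⟩
      rw [segment_eq_image] at hy
      obtain ⟨s, ⟨h0, h1⟩, rfl⟩ := hy
      intro α hα
      have := hseg s h0 h1 α hα
      simpa [toC] using this)
  have main := Complex.HadamardThreeLines.norm_le_interp_of_mem_verticalClosedStrip₀₁'
    (fun z : ℂ => G (P + z • V)) (z := ((T⁻¹ : ℝ) : ℂ))
    (a := (1 + |x j|) ^ N * B)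
    (b := δ⁻¹ ^ N * (Cη * Real.exp (M * (T * ‖η‖)))) ?_ ?_ ?_ ?_ ?_
  · have e : P + ((T⁻¹ : ℝ) : ℂ) • V = L := by rw [hL]; push_cast; rfl
    simp only [e, Complex.ofReal_re] at main
    refine main.trans (le_of_eq ?_)
    congr 1
    rw [← mul_assoc, Real.mul_rpow (by positivity) (by positivity), ← Real.exp_mul]
    congr 2
    field_simp
  · simp only [Complex.HadamardThreeLines.verticalClosedStrip, Set.mem_preimage,
      Complex.ofReal_re, Set.mem_Icc]
    exact ⟨by positivity, inv_le_one_of_one_le₀ hT⟩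
  · apply DifferentiableOn.diffContOnCl
    intro z hz
    have hz' : z ∈ Complex.HadamardThreeLines.verticalClosedStrip 0 1 := by
      refine closure_minimal ?_ ?_ hz
      · exact Set.preimage_mono Set.Ioo_subset_Icc_self
      · exact isClosed_Icc.preimage Complex.continuous_re
    obtain ⟨h0, h1⟩ := hz'
    apply DifferentiableAt.differentiableWithinAt
    have d1 : DifferentiableAt ℂ φ (P + z • V) :=
      (hφ.1 _ (hmem z h0 h1)).differentiableAt ((aStar_isOpen d Sp R).mem_nhds (hmem z h0 h1))
    have d2 : DifferentiableAt ℂ (fun z : ℂ => φ (P + z • V)) z :=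
      DifferentiableAt.comp z d1 (by fun_prop)
    have hne : (1 + δ * ((1 + |x j| : ℝ) + σ * (P + z • V) j) : ℂ) ≠ 0 := by
      have := hden _ (hell z h0 h1)
      intro h
      rw [h, norm_zero] at this
      linarith
    simp only [hG]
    refine d2.fun_mul (DifferentiableAt.fun_pow (DifferentiableAt.fun_div ?_ ?_ (by exact hne)) N)
    · simp only [PiLp.add_apply, PiLp.smul_apply]; fun_prop
    · simp only [PiLp.add_apply, PiLp.smul_apply]; fun_prop
  · refine ⟨K * δ⁻¹ ^ N, ?_⟩
    rintro _ ⟨z, ⟨h0, h1⟩, rfl⟩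
    have k1 := hK (P + z • V) (by
      rw [hreP, segment_eq_image]
      exact ⟨z.re, ⟨h0, h1⟩, rfl⟩)
    rw [pow_zero, one_mul] at k1
    simp only [Function.comp, hG]
    rw [norm_mul]
    exact mul_le_mul k1 (hq2 _ (hell z h0 h1)) (norm_nonneg _) ((norm_nonneg _).trans k1)
  · intro z hz
    have hz : z.re = 0 := hz
    have k1 := hB (P + z • V) (by rw [hreP, hz]; simp)
    simp only [hG]
    rw [norm_mul]
    have k2 := hq1 _ (hell z hz.ge (by rw [hz]; norm_num))
    have k3 : ‖((1 + |x j| : ℝ) : ℂ) + σ * (P + z • V) j‖ ≤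
        (1 + |x j|) * (1 + ‖P + z • V‖) := by
      refine (norm_add_le _ _).trans ?_
      rw [norm_mul, Complex.norm_real, Complex.norm_real, Real.norm_eq_abs σ, hσ,
        Real.norm_of_nonneg (by positivity)]
      have := PiLp.norm_apply_le (P + z • V) j
      have := abs_nonneg (x j)
      have := norm_nonneg (P + z • V)
      nlinarith
    calc _ ≤ ‖φ (P + z • V)‖ * ((1 + |x j|) * (1 + ‖P + z • V‖)) ^ N := by
            gcongr
            exact k2.trans (pow_le_pow_left₀ (norm_nonneg _) k3 N)
      _ = (1 + |x j|) ^ N * ((1 + ‖P + z • V‖) ^ N * ‖φ (P + z • V)‖) := by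
            rw [mul_pow]; ring
      _ ≤ _ := by gcongr
  · intro z hz
    have hz : z.re = 1 := hz
    have k1 := hb (P + z • V) (by rw [hreP, hz]; simp)
    simp only [hG]
    rw [norm_mul, mul_comm]
    exact mul_le_mul (hq2 _ (hell z (by rw [hz]; norm_num) hz.le)) k1 (norm_nonneg _)
      (by positivity)

open Filter Topology in
lemma core2 (d : ℕ) (Sp : Finset (Ed d)) (R M : ℝ) (φ : Cd d → ℂ) (hφ : memQM d Sp R M φ)
    (x η : Ed d) (hx : toC d x ∈ aStar d Sp R) (hη : Antidom d Sp η)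
    (N : ℕ) (B : ℝ)
    (hB : ∀ l : Cd d, rePart d l = x → (1 + ‖l‖) ^ N * ‖φ l‖ ≤ B)
    (j : Fin d) (σ : ℝ) (hσ : |σ| = 1) (hση : 0 ≤ σ * η j)
    (l : Cd d) (hl : rePart d l = x + η) (hlm : l ∈ aStar d Sp R) :
    ‖φ l‖ * ‖((1 + |x j| : ℝ) + σ * l j : ℂ)‖ ^ N ≤
      (1 + |x j|) ^ N * B * Real.exp (M * ‖η‖) := by
  obtain ⟨tη, Cη, ht, hC, hbd⟩ := hφ.2 η hη
  set w : ℂ := ((1 + |x j| : ℝ) + σ * l j : ℂ) with hw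
  have hσx : -|x j| ≤ σ * x j := by
    have := neg_abs_le (σ * x j)
    rwa [abs_mul, hσ, one_mul] at this
  have hwre : 1 ≤ w.re := by
    rw [hw, Complex.add_re, Complex.re_ofReal_mul, Complex.ofReal_re]
    have : (l j).re = x j + η j := by
      have := congrArg (fun v : Ed d => v j) hl
      simpa [rePart] using this
    rw [this]
    linarith
  set P : Cd d := l - toC d η with hPdef
  have hP : rePart d P = x := by
    ext i
    have := congrArg (fun v : Ed d => v i) hl
    simp [rePart, toC, hPdef] at this ⊢
    linarith
  have hden : ∀ δ : ℝ, 0 < δ → (1 + δ * w : ℂ) ≠ 0 := by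
    intro δ hδ h
    have := congrArg Complex.re h
    rw [Complex.add_re, Complex.re_ofReal_mul, Complex.one_re, Complex.zero_re] at this
    nlinarith
  have evT : ∀ᶠ T : ℝ in atTop, toC d (T • η) ∈ aStar d Sp R := by
    have : ∀ α ∈ Sp, ∀ᶠ T : ℝ in atTop, (∑ i, ((toC d (T • η)) i).re * α i) < R := by
      intro α hα
      have h1 := hη α hα
      have h2 : Tendsto (fun T : ℝ => T * ∑ i, η i * α i) atTop atBot :=
        tendsto_id.atTop_mul_const_of_neg h1
      filter_upwards [h2.eventually (eventually_lt_atBot R)] with T hT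
      refine lt_of_eq_of_lt ?_ hT
      rw [Finset.mul_sum]
      refine Finset.sum_congr rfl fun i _ => ?_
      simp [toC]; ring
    exact (Filter.eventually_all_finset Sp).2 this
  have step : ∀ δ : ℝ, 0 < δ → ‖φ l * (w / (1 + δ * w)) ^ N‖ ≤
      (1 + |x j|) ^ N * B * Real.exp (M * ‖η‖) := by
    intro δ hδ
    have hinv : Tendsto (fun T : ℝ => T⁻¹) atTop (𝓝 0) := tendsto_inv_atTop_zero
    have hinvC : Tendsto (fun T : ℝ => (T⁻¹ : ℂ)) atTop (𝓝 0) := by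
      have := (Complex.continuous_ofReal.tendsto 0).comp hinv
      simpa [Function.comp_def] using this
    have hLt : Tendsto (fun T : ℝ => l - (T⁻¹ : ℂ) • toC d x) atTop (𝓝 l) := by
      have := (tendsto_const_nhds (x := l)).sub (hinvC.smul_const (toC d x))
      simpa using this
    have hGc : ContinuousAt (fun l : Cd d =>
        φ l * (((1 + |x j| : ℝ) + σ * l j) / (1 + δ * ((1 + |x j| : ℝ) + σ * l j))) ^ N) l := by
      have c1 : ContinuousAt φ l :=
        (hφ.1.1 l hlm).continuousWithinAt.continuousAt ((aStar_isOpen d Sp R).mem_nhds hlm)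
      refine c1.mul (ContinuousAt.pow (ContinuousAt.div ?_ ?_ (by exact hden δ hδ)) N)
      · fun_prop
      · fun_prop
    have lhs := (hGc.tendsto.comp hLt).norm
    have rhs : Tendsto (fun T : ℝ => ((1 + |x j|) ^ N * B) ^ (1 - T⁻¹) *
        ((δ⁻¹ ^ N * Cη) ^ (T⁻¹) * Real.exp (M * ‖η‖))) atTop
        (𝓝 (((1 + |x j|) ^ N * B) ^ (1 - (0:ℝ)) *
        ((δ⁻¹ ^ N * Cη) ^ (0:ℝ) * Real.exp (M * ‖η‖)))) := by
      refine Tendsto.mul ?_ (Tendsto.mul_const _ ?_)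
      · exact (Real.continuousAt_const_rpow' (by norm_num)).tendsto.comp
          (tendsto_const_nhds.sub hinv)
      · exact (Real.continuousAt_const_rpow (by positivity)).tendsto.comp hinv
    have := le_of_tendsto_of_tendsto lhs rhs (by
      filter_upwards [evT, eventually_ge_atTop 1, eventually_ge_atTop tη] with T h1 h2 h3
      have hT0 : 0 < T := by linarith
      refine core1 d Sp R M φ hφ.1 x η hx T Cη h2 hC h1 ?_ N B hB j σ hσ hση δ hδ P hP _ ?_
      · intro l' hl'
        refine (hbd T h3 l' hl').trans ?_
        rw [hl', norm_smul, Real.norm_of_nonneg hT0.le]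
        have : (1 + ‖l'‖) ^ (-(d : ℝ) - 1) ≤ 1 :=
          Real.rpow_le_one_of_one_le_of_nonpos (by linarith [norm_nonneg l'])
            (by have : (0:ℝ) ≤ d := Nat.cast_nonneg d
                linarith)
        gcongr
        exact mul_le_of_le_one_right hC.le this
      · have hTc : (T : ℂ) ≠ 0 := by exact_mod_cast hT0.ne'
        ext i
        simp [hPdef, toC]
        field_simp
        ring)
    rw [sub_zero, Real.rpow_one, Real.rpow_zero, one_mul] at this
    exact this
  have step2 : ∀ δ : ℝ, 0 < δ → ‖φ l‖ * ‖w‖ ^ N ≤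
      (1 + |x j|) ^ N * B * Real.exp (M * ‖η‖) * ‖1 + δ * w‖ ^ N := by
    intro δ hδ
    have := step δ hδ
    have hp : 0 < ‖1 + δ * w‖ ^ N := pow_pos (norm_pos_iff.2 (hden δ hδ)) N
    rw [norm_mul, norm_pow, norm_div, div_pow, ← mul_div_assoc, div_le_iff₀ hp] at this
    exact this
  have lim : Tendsto (fun δ : ℝ => (1 + |x j|) ^ N * B * Real.exp (M * ‖η‖) *
      ‖1 + δ * w‖ ^ N) (𝓝[>] 0) (𝓝 ((1 + |x j|) ^ N * B * Real.exp (M * ‖η‖) *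
      ‖1 + ((0 : ℝ) : ℂ) * w‖ ^ N)) := by
    refine Tendsto.mono_left (Continuous.tendsto ?_ 0) nhdsWithin_le_nhds
    fun_prop
  have := ge_of_tendsto lim (by
    filter_upwards [self_mem_nhdsWithin] with δ hδ using step2 δ hδ)
  simpa using this

lemma core3 (d : ℕ) (hd : 1 ≤ d) (Sp : Finset (Ed d)) (R M : ℝ) (hM : 0 < M)
    (φ : Cd d → ℂ) (hφ : memQM d Sp R M φ)
    (x η : Ed d) (hx : toC d x ∈ aStar d Sp R) (hη : Antidom d Sp η)
    (N : ℕ) (B : ℝ) (hB0 : 0 ≤ B)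
    (hB : ∀ l : Cd d, rePart d l = x → (1 + ‖l‖) ^ N * ‖φ l‖ ≤ B)
    (l : Cd d) (hl : rePart d l = x + η) (hlm : l ∈ aStar d Sp R) :
    ‖φ l‖ * (1 + ‖l‖) ^ N ≤
      (3 * d * (1 + ‖x‖) ^ 2) ^ N * Real.exp (M * ‖x‖) * Real.exp (M * ‖rePart d l‖) * B := by
  have : Nonempty (Fin d) := ⟨⟨0, hd⟩⟩
  obtain ⟨j, hj⟩ := Finite.exists_max (fun j => ‖l j‖)
  obtain ⟨σ, hσ, hση⟩ : ∃ σ : ℝ, |σ| = 1 ∧ σ * η j = |η j| := by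
    rcases le_total 0 (η j) with h | h
    · exact ⟨1, by simp, by simp [abs_of_nonneg h]⟩
    · exact ⟨-1, by simp, by simp [abs_of_nonpos h]⟩
  have key := core2 d Sp R M φ hφ x η hx hη N B hB j σ hσ (by rw [hση]; positivity) l hl hlm
  set w : ℂ := ((1 + |x j| : ℝ) + σ * l j : ℂ) with hw
  have hxj : |x j| ≤ ‖x‖ := PiLp.norm_apply_le x j
  have hljre : (l j).re = x j + η j := by
    have := congrArg (fun v : Ed d => v j) hl
    simpa [rePart] using this
  have hσx : -|x j| ≤ σ * x j := by
    have := neg_abs_le (σ * x j)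
    rwa [abs_mul, hσ, one_mul] at this
  have hw1 : 1 + |η j| ≤ ‖w‖ := by
    refine le_trans ?_ (Complex.re_le_norm _)
    rw [hw, Complex.add_re, Complex.re_ofReal_mul, Complex.ofReal_re, hljre]
    linarith
  have hw2 : |(l j).im| ≤ ‖w‖ := by
    refine le_trans (le_of_eq ?_) (Complex.abs_im_le_norm _)
    rw [hw, Complex.add_im, Complex.im_ofReal_mul, Complex.ofReal_im, zero_add, abs_mul, hσ,
      one_mul]
  have hlj : ‖l j‖ ≤ |x j| + |η j| + |(l j).im| := by
    refine (Complex.norm_le_abs_re_add_abs_im _).trans ?_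
    rw [hljre]
    linarith [abs_add_le (x j) (η j)]
  have hln : ‖l‖ ≤ d * ‖l j‖ := by
    have h1 : ‖l‖ ≤ ∑ i, ‖l i‖ := by
      rw [EuclideanSpace.norm_eq]
      rw [Real.sqrt_le_left (Finset.sum_nonneg fun i _ => norm_nonneg _)]
      exact Finset.sum_sq_le_sq_sum_of_nonneg fun i _ => norm_nonneg _
    refine h1.trans ((Finset.sum_le_sum fun i _ => hj i).trans ?_)
    simp
  have hd' : (1 : ℝ) ≤ d := by exact_mod_cast hd
  have hx0 := norm_nonneg x
  have hη0 := abs_nonneg (η j)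
  have hlw : 1 + ‖l‖ ≤ 3 * d * (1 + ‖x‖) * ‖w‖ := by
    have a1 : 1 + ‖l j‖ ≤ 2 * (1 + ‖x‖) * ‖w‖ := by
      nlinarith
    have a2 : 1 + ‖l‖ ≤ d * (1 + ‖l j‖) := by nlinarith
    have a3 : 0 ≤ (d : ℝ) * ((1 + ‖x‖) * ‖w‖) := by positivity
    nlinarith
  have hηn : ‖η‖ ≤ ‖x‖ + ‖rePart d l‖ := by
    have : η = rePart d l - x := by rw [hl]; simp
    rw [this]
    linarith [norm_sub_le (rePart d l) x]
  calc ‖φ l‖ * (1 + ‖l‖) ^ N ≤ ‖φ l‖ * (3 * d * (1 + ‖x‖) * ‖w‖) ^ N := by gcongr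
    _ = (3 * d * (1 + ‖x‖)) ^ N * (‖φ l‖ * ‖w‖ ^ N) := by rw [mul_pow]; ring
    _ ≤ (3 * d * (1 + ‖x‖)) ^ N * ((1 + |x j|) ^ N * B * Real.exp (M * ‖η‖)) := by gcongr
    _ ≤ (3 * d * (1 + ‖x‖)) ^ N * ((1 + ‖x‖) ^ N * B * Real.exp (M * (‖x‖ + ‖rePart d l‖))) := by
        gcongr
    _ = _ := by
        rw [mul_add M, Real.exp_add, sq, ← mul_assoc (3 * (d : ℝ)), mul_pow (3 * (d : ℝ) * (1 + ‖x‖)) (1 + ‖x‖)]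
        ring

theorem uniform_estimate_on_shifted_cone
    (d : ℕ) (hd : 1 ≤ d) (Sp : Finset (Ed d)) (hSp : (0 : Ed d) ∉ Sp) (R : ℝ)
    (lam0 : Ed d) (hlam0 : toC d lam0 ∈ aStar d Sp R)
    (ω : Set (Ed d)) (hωc : IsCompact ω) (hωsub : toC d '' ω ⊆ aStar d Sp R)
    (hωnb : ω ∈ nhds lam0)
    (M : ℝ) (hM : 0 < M) (N : ℕ) :
    ∃ (n : ℕ) (C : ℝ), 0 < C ∧
      ∀ φ : Cd d → ℂ, memQM d Sp R M φ →
        ∀ l : Cd d, l - toC d lam0 ∈ closure (aStar d Sp 0) →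
          ‖φ l‖ ≤
            C * (1 + ‖l‖) ^ (-(N : ℝ)) * Real.exp (M * ‖rePart d l‖) * nu d ω n φ := by
  have hlω : lam0 ∈ ω := mem_of_mem_nhds hωnb
  set K : ℝ := (3 * d * (1 + ‖lam0‖) ^ 2) ^ N * Real.exp (M * ‖lam0‖) with hK
  have hd' : (0 : ℝ) < d := by exact_mod_cast hd
  refine ⟨N, K, by positivity, ?_⟩
  intro φ hφ l hl
  have hbdd : BddAbove {r : ℝ | ∃ l : Cd d, rePart d l ∈ ω ∧ r = (1 + ‖l‖) ^ N * ‖φ l‖} := by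
    obtain ⟨C, hC⟩ := hφ.1.2 N ω hωc.isBounded hωsub
    refine ⟨C, ?_⟩
    rintro _ ⟨l, h, rfl⟩
    exact hC l h
  have hB : ∀ l : Cd d, rePart d l = lam0 → (1 + ‖l‖) ^ N * ‖φ l‖ ≤ nu d ω N φ := by
    intro l hl
    exact le_csSup hbdd ⟨l, by rw [hl]; exact hlω, rfl⟩
  have hB0 : 0 ≤ nu d ω N φ := by
    apply Real.sSup_nonneg
    rintro _ ⟨l, _, rfl⟩
    positivity
  have hsum : ∀ μ : Cd d, ∀ α : Ed d, ∑ j, ((toC d lam0 + μ) j).re * α j =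
      ∑ j, (toC d lam0 j).re * α j + ∑ j, (μ j).re * α j := by
    intro μ α
    rw [← Finset.sum_add_distrib]
    refine Finset.sum_congr rfl fun i _ => ?_
    simp [add_mul]
  have hcl : ∀ μ ∈ closure (aStar d Sp 0), toC d lam0 + μ ∈ aStar d Sp R := by
    intro μ hμ α hα
    have h1 : (∑ j, (μ j).re * α j) ≤ 0 := by
      have : IsClosed {μ : Cd d | (∑ j, (μ j).re * α j) ≤ 0} :=
        isClosed_le (by fun_prop) continuous_const
      exact closure_minimal (fun μ h => (h α hα).le) this hμ
    have h2 := hlam0 α hα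
    rw [hsum]
    linarith
  have hopen : ∀ μ ∈ aStar d Sp 0, ‖φ (toC d lam0 + μ)‖ * (1 + ‖toC d lam0 + μ‖) ^ N ≤
      K * Real.exp (M * ‖rePart d (toC d lam0 + μ)‖) * nu d ω N φ := by
    intro μ hμ
    refine core3 d hd Sp R M hM φ hφ lam0 (rePart d μ) hlam0 (fun α hα => hμ α hα) N _ hB0 hB _ ?_
      (hcl μ (subset_closure hμ))
    ext i
    simp [rePart, toC]
  have hrec : Continuous (rePart d) := by
    unfold rePart
    fun_prop
  have hμl : toC d lam0 + (l - toC d lam0) = l := by abel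
  have hfin : ‖φ l‖ * (1 + ‖l‖) ^ N ≤ K * Real.exp (M * ‖rePart d l‖) * nu d ω N φ := by
    have hlm : l ∈ aStar d Sp R := by rw [← hμl]; exact hcl _ hl
    have c1 : ContinuousAt φ l :=
      (hφ.1.1 l hlm).continuousWithinAt.continuousAt ((aStar_isOpen d Sp R).mem_nhds hlm)
    have c2 : ContinuousAt (fun μ => φ (toC d lam0 + μ)) (l - toC d lam0) := by
      apply ContinuousAt.comp (g := φ)
      · rw [hμl]; exact c1
      · fun_prop
    have := ContinuousWithinAt.closure_le hl
      (f := fun μ => ‖φ (toC d lam0 + μ)‖ * (1 + ‖toC d lam0 + μ‖) ^ N)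
      (g := fun μ => K * Real.exp (M * ‖rePart d (toC d lam0 + μ)‖) * nu d ω N φ)
      (ContinuousAt.continuousWithinAt (c2.norm.mul (by fun_prop)))
      (Continuous.continuousWithinAt (by fun_prop)) hopen
    simpa only [hμl] using this
  have hp : 0 < (1 + ‖l‖) ^ N := by positivity
  rw [Real.rpow_neg (by positivity), Real.rpow_natCast]
  rw [← le_div_iff₀ hp] at hfin
  refine hfin.trans (le_of_eq ?_)
  field_simp
end
end

section
/- Let p ∈ Π_ℝ. Then for each u ∈ S(ℝ^d) there exists an element u' ∈ S(ℝ^d) such that u'(p·φ)(0) = u(φ)(0) for every function φ holomorphic on some open neighborhood of 0 in ℂ^d. -/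
noncomputable section

/-- Directional derivative ∂_v, for v ∈ ℝ^d, acting on functions on ℂ^d. -/
def dirDeriv (d : ℕ) (v : Fin d → ℝ) (g : (Fin d → ℂ) → ℂ) : (Fin d → ℂ) → ℂ :=
  fun z => fderiv ℂ g z (fun j => (v j : ℂ))

/-- Iterated directional derivative ∂_v^n. -/
def dirDerivPow (d : ℕ) (v : Fin d → ℝ) : ℕ → ((Fin d → ℂ) → ℂ) → (Fin d → ℂ) → ℂ
  | 0 => id
  | n + 1 => fun g => dirDeriv d v (dirDerivPow d v n g)

/-- The multi-index derivative ∂^γ = ∂_1^{γ 1} ∘ ⋯ ∘ ∂_d^{γ d}. -/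
def multiDeriv (d : ℕ) (γ : Fin d →₀ ℕ) (g : (Fin d → ℂ) → ℂ) : (Fin d → ℂ) → ℂ :=
  (List.finRange d).foldr (fun j h => dirDerivPow d (Pi.single j 1) (γ j) h) g

/-- The action of an element u ∈ S(ℝ^d), encoded as a real polynomial in the partial
derivatives ∂_1, …, ∂_d, on a function on ℂ^d. -/
def applyOp (d : ℕ) (u : MvPolynomial (Fin d) ℝ) (g : (Fin d → ℂ) → ℂ) :
    (Fin d → ℂ) → ℂ :=
  fun z => ∑ γ ∈ u.support, (Complex.ofReal (u.coeff γ)) * multiDeriv d γ g z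

/-- Membership in Π_ℝ: p is a finite product of affine functions λ ↦ ⟨ξ,λ⟩ + c with
ξ ∈ ℝ^d \ {0} and c ∈ ℝ. -/
def IsPiR (d : ℕ) (p : (Fin d → ℂ) → ℂ) : Prop :=
  ∃ L : List ((Fin d → ℝ) × ℝ),
    (∀ q ∈ L, q.1 ≠ 0) ∧
    p = fun l => (L.map (fun q => (∑ j, (q.1 j : ℂ) * l j) + (q.2 : ℂ))).prod

theorem aux_diff_fderiv (d : ℕ) (f : (Fin d → ℂ) → ℂ) (U : Set (Fin d → ℂ)) (hU : IsOpen U)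
    (hf : DifferentiableOn ℂ f U) (v : Fin d → ℂ) :
    DifferentiableOn ℂ (fun z => fderiv ℂ f z v) U := by
  intro z0 hz0
  apply DifferentiableAt.differentiableWithinAt
  have hfc : ContinuousAt f z0 := (hf.differentiableAt (hU.mem_nhds hz0)).continuousAt
  obtain ⟨R, hR, hball⟩ : ∃ R > 0, ∀ z ∈ Metric.ball z0 R, z ∈ U ∧ f z ∈ Metric.ball (f z0) 1 :=
    Metric.eventually_nhds_iff_ball.mp
      ((hU.eventually_mem hz0).and (hfc.eventually (Metric.ball_mem_nhds _ one_pos)))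
  have hdiff : ∀ z ∈ Metric.ball z0 R, DifferentiableAt ℂ f z := fun z hz =>
    hf.differentiableAt (hU.mem_nhds (hball z hz).1)
  have hbd : ∀ z ∈ Metric.ball z0 (R/2), ‖fderiv ℂ f z‖ ≤ 2 / (R/2) := by
    intro z hz
    have hsub : Metric.ball z (R/2) ⊆ Metric.ball z0 R := by
      apply Metric.ball_subset_ball'
      rw [Metric.mem_ball] at hz
      linarith
    refine Complex.norm_fderiv_le_div_of_mapsTo_ball
      (fun w hw => (hdiff w (hsub hw)).differentiableWithinAt) ?_ (by positivity)
    intro w hw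
    have h1 := (hball w (hsub hw)).2
    have h2 := (hball z (hsub (Metric.mem_ball_self (by positivity)))).2
    rw [Metric.mem_closedBall]
    rw [Metric.mem_ball] at h1 h2
    have := dist_triangle_right (f w) (f z) (f z0)
    linarith
  obtain ⟨r, hr, hrv⟩ : ∃ r > 0, r * ‖v‖ < R / 4 := by
    refine ⟨R / 4 / (‖v‖ + 1), by positivity, ?_⟩
    have : 0 ≤ ‖v‖ := norm_nonneg v
    rw [div_mul_eq_mul_div, div_lt_iff₀ (by positivity)]
    nlinarith
  have hmem : ∀ z ∈ Metric.ball z0 (R/4), ∀ w : ℂ, ‖w‖ ≤ r → z + w • v ∈ Metric.ball z0 (R/2) := by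
    intro z hz w hw
    rw [Metric.mem_ball, dist_eq_norm] at *
    have h1 : ‖w • v‖ ≤ r * ‖v‖ := by rw [norm_smul]; gcongr
    have h2 : z + w • v - z0 = (z - z0) + w • v := by abel
    rw [h2]
    have := norm_add_le (z - z0) (w • v)
    linarith
  have hhalf : Metric.ball z0 (R/2) ⊆ Metric.ball z0 R := Metric.ball_subset_ball (by linarith)
  let c : ℝ → ℂ := fun θ => deriv (circleMap 0 r) θ * ((circleMap 0 r θ) ^ 2)⁻¹
  have hcm0 : ∀ θ, circleMap 0 r θ ≠ 0 := fun θ => by simp [circleMap, hr.ne']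
  have hcc : Continuous c := by
    have h0 : Continuous (circleMap 0 r) := continuous_circleMap 0 r
    simp only [c, deriv_circleMap]
    exact (h0.mul continuous_const).mul ((h0.pow 2).inv₀ (fun θ => pow_ne_zero 2 (hcm0 θ)))
  have hcn : ∀ θ, ‖circleMap 0 r θ‖ ≤ r := fun θ => by simp [abs_of_pos hr]
  have hcF : ∀ z ∈ Metric.ball z0 (R/4), Continuous (fun θ => c θ * f (z + circleMap 0 r θ • v)) := by
    intro z hz
    refine hcc.mul ?_
    rw [continuous_iff_continuousAt]
    intro θ
    have h1 := (hdiff _ (hhalf (hmem z hz _ (hcn θ)))).continuousAt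
    exact ContinuousAt.comp (f := fun θ => z + circleMap 0 r θ • v) h1 (by fun_prop)
  have key : ∀ z ∈ Metric.ball z0 (R/4), fderiv ℂ f z v =
      (2 * Real.pi * Complex.I : ℂ)⁻¹ *
        ∫ θ in (0)..(2 * Real.pi), c θ * f (z + circleMap 0 r θ • v) := by
    intro z hz
    let g : ℂ → ℂ := fun w => f (z + w • v)
    have hV : IsOpen ((fun w : ℂ => z + w • v) ⁻¹' (Metric.ball z0 R)) :=
      Metric.isOpen_ball.preimage (by fun_prop)
    have hg : DifferentiableOn ℂ g ((fun w : ℂ => z + w • v) ⁻¹' (Metric.ball z0 R)) := by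
      intro w hw
      exact (DifferentiableAt.comp (f := fun w : ℂ => z + w • v) w (hdiff _ hw)
        (by fun_prop)).differentiableWithinAt
    have h1 := Complex.cderiv_eq_deriv (z := 0) hV hg hr (by
      intro w hw
      exact hhalf (hmem z hz w (by simpa using hw)))
    have h2 : deriv g 0 = fderiv ℂ f z v := by
      have hz' : HasFDerivAt f (fderiv ℂ f z) (z + (0:ℂ) • v) := by
        simpa using (hdiff z (Metric.ball_subset_ball (by linarith) hz)).hasFDerivAt
      have hl : HasDerivAt (fun w : ℂ => z + w • v) v 0 := by
        simpa using ((hasDerivAt_id (0:ℂ)).smul_const v).const_add z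
      exact (hz'.comp_hasDerivAt (0:ℂ) hl).deriv
    rw [← h2, ← h1, Complex.cderiv, circleIntegral]
    simp only [c, g, smul_eq_mul, sub_zero, mul_assoc]
  have hs : Metric.ball z0 (R/4) ∈ nhds z0 := Metric.ball_mem_nhds _ (by positivity)
  have hz00 : z0 ∈ Metric.ball z0 (R/4) := Metric.mem_ball_self (by positivity)
  have hint := intervalIntegral.hasFDerivAt_integral_of_dominated_of_fderiv_le (𝕜 := ℂ)
    (μ := MeasureTheory.volume) (a := 0) (b := 2 * Real.pi)
    (F := fun z θ => c θ * f (z + circleMap 0 r θ • v))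
    (F' := fun z θ => c θ • fderiv ℂ f (z + circleMap 0 r θ • v))
    (x₀ := z0) (bound := fun θ => ‖c θ‖ * (2 / (R/2))) hs
    (by filter_upwards [hs] with z hz using (hcF z hz).aestronglyMeasurable)
    ((hcF z0 hz00).intervalIntegrable _ _)
    (by
      apply Measurable.aestronglyMeasurable
      refine hcc.measurable.smul ((measurable_fderiv ℂ f).comp ?_)
      exact Continuous.measurable (by fun_prop))
    (by
      refine Filter.Eventually.of_forall fun θ _ z hz => ?_
      rw [norm_smul]
      exact mul_le_mul_of_nonneg_left (hbd _ (hmem z hz _ (hcn θ))) (norm_nonneg _))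
    ((hcc.norm.mul continuous_const).intervalIntegrable _ _)
    (by
      refine Filter.Eventually.of_forall fun θ _ z hz => ?_
      have h1 := (hdiff _ (hhalf (hmem z hz _ (hcn θ)))).hasFDerivAt
      have h2 : HasFDerivAt (fun z => z + circleMap 0 r θ • v) (ContinuousLinearMap.id ℂ _) z :=
        (hasFDerivAt_id z).add_const _
      have h3 := (h1.comp z h2).const_mul (c θ)
      simpa using h3)
  have := (hint.const_mul (2 * Real.pi * Complex.I : ℂ)⁻¹).differentiableAt
  refine this.congr_of_eventuallyEq ?_
  filter_upwards [hs] with z hz using key z hz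

section Helpers
variable {d : ℕ} {U : Set (Fin d → ℂ)}

theorem aux_dd_diff (hU : IsOpen U) (v : Fin d → ℝ) {g : (Fin d → ℂ) → ℂ}
    (hg : DifferentiableOn ℂ g U) : DifferentiableOn ℂ (dirDeriv d v g) U :=
  aux_diff_fderiv d g U hU hg _

theorem aux_dd_congr (hU : IsOpen U) (v : Fin d → ℝ) {g h : (Fin d → ℂ) → ℂ}
    (hg : Set.EqOn g h U) : Set.EqOn (dirDeriv d v g) (dirDeriv d v h) U := by
  intro z hz
  unfold dirDeriv
  rw [(hg.eventuallyEq_of_mem (hU.mem_nhds hz)).fderiv_eq]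

theorem aux_ddp_diff (hU : IsOpen U) (v : Fin d → ℝ) (n : ℕ) {g : (Fin d → ℂ) → ℂ}
    (hg : DifferentiableOn ℂ g U) : DifferentiableOn ℂ (dirDerivPow d v n g) U := by
  induction n with
  | zero => exact hg
  | succ n ih => exact aux_dd_diff hU v ih

theorem aux_ddp_congr (hU : IsOpen U) (v : Fin d → ℝ) (n : ℕ) {g h : (Fin d → ℂ) → ℂ}
    (hg : Set.EqOn g h U) : Set.EqOn (dirDerivPow d v n g) (dirDerivPow d v n h) U := by
  induction n with
  | zero => exact hg
  | succ n ih => exact aux_dd_congr hU v ih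

theorem aux_dd_add (hU : IsOpen U) (v : Fin d → ℝ) {g h : (Fin d → ℂ) → ℂ}
    (hg : DifferentiableOn ℂ g U) (hh : DifferentiableOn ℂ h U) :
    Set.EqOn (dirDeriv d v (fun z => g z + h z)) (fun z => dirDeriv d v g z + dirDeriv d v h z) U := by
  intro z hz
  simp only [dirDeriv]
  rw [fderiv_fun_add (hg.differentiableAt (hU.mem_nhds hz)) (hh.differentiableAt (hU.mem_nhds hz))]
  rfl

theorem aux_dd_smul (hU : IsOpen U) (v : Fin d → ℝ) (a : ℂ) {g : (Fin d → ℂ) → ℂ}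
    (hg : DifferentiableOn ℂ g U) :
    Set.EqOn (dirDeriv d v (fun z => a * g z)) (fun z => a * dirDeriv d v g z) U := by
  intro z hz
  simp only [dirDeriv]
  rw [fderiv_const_mul (hg.differentiableAt (hU.mem_nhds hz))]
  rfl

theorem aux_ddp_add (hU : IsOpen U) (v : Fin d → ℝ) (n : ℕ) {g h : (Fin d → ℂ) → ℂ}
    (hg : DifferentiableOn ℂ g U) (hh : DifferentiableOn ℂ h U) :
    Set.EqOn (dirDerivPow d v n (fun z => g z + h z))
      (fun z => dirDerivPow d v n g z + dirDerivPow d v n h z) U := by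
  induction n with
  | zero => intro z _; rfl
  | succ n ih =>
    exact (aux_dd_congr hU v ih).trans
      (aux_dd_add hU v (aux_ddp_diff hU v n hg) (aux_ddp_diff hU v n hh))

theorem aux_ddp_smul (hU : IsOpen U) (v : Fin d → ℝ) (n : ℕ) (a : ℂ) {g : (Fin d → ℂ) → ℂ}
    (hg : DifferentiableOn ℂ g U) :
    Set.EqOn (dirDerivPow d v n (fun z => a * g z))
      (fun z => a * dirDerivPow d v n g z) U := by
  induction n with
  | zero => intro z _; rfl
  | succ n ih =>
    exact (aux_dd_congr hU v ih).trans (aux_dd_smul hU v a (aux_ddp_diff hU v n hg))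

theorem aux_ddp_zero (hU : IsOpen U) (v : Fin d → ℝ) (n : ℕ) :
    Set.EqOn (dirDerivPow d v n (fun _ => 0)) (fun _ => 0) U := by
  have := aux_ddp_smul hU v n 0 (g := fun _ => 0) (differentiableOn_const 0)
  simpa using this

theorem aux_sum_diff {ι : Type*} (l : List ι) (G : ι → (Fin d → ℂ) → ℂ)
    (hG : ∀ i, DifferentiableOn ℂ (G i) U) :
    DifferentiableOn ℂ (fun z => (l.map (fun i => G i z)).sum) U := by
  induction l with
  | nil => simp
  | cons i l ih =>
    simp only [List.map_cons, List.sum_cons]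
    exact (hG i).add ih

theorem aux_ddp_sum (hU : IsOpen U) (v : Fin d → ℝ) (n : ℕ) {ι : Type*} (l : List ι)
    (a : ι → ℂ) (G : ι → (Fin d → ℂ) → ℂ) (hG : ∀ i, DifferentiableOn ℂ (G i) U) :
    Set.EqOn (dirDerivPow d v n (fun z => (l.map (fun i => a i * G i z)).sum))
      (fun z => (l.map (fun i => a i * dirDerivPow d v n (G i) z)).sum) U := by
  induction l with
  | nil => simpa using aux_ddp_zero hU v n
  | cons i l ih =>
    simp only [List.map_cons, List.sum_cons]
    refine (aux_ddp_add hU v n ((hG i).const_mul (a i))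
      (aux_sum_diff l (fun i z => a i * G i z) (fun i => (hG i).const_mul (a i)))).trans ?_
    intro z hz
    simp only
    rw [ih hz, aux_ddp_smul hU v n (a i) (hG i) hz]

/-- The affine function. -/
def auxAff (d : ℕ) (q : (Fin d → ℝ) × ℝ) : (Fin d → ℂ) → ℂ :=
  fun l => (∑ j, (q.1 j : ℂ) * l j) + (q.2 : ℂ)

theorem aux_aff_diff (q : (Fin d → ℝ) × ℝ) : Differentiable ℂ (auxAff d q) := by
  unfold auxAff
  fun_prop

theorem aux_dd_aff (hU : IsOpen U) (q : (Fin d → ℝ) × ℝ) (i : Fin d) {g : (Fin d → ℂ) → ℂ}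
    (hg : DifferentiableOn ℂ g U) :
    Set.EqOn (dirDeriv d (Pi.single i 1) (fun z => auxAff d q z * g z))
      (fun z => auxAff d q z * dirDeriv d (Pi.single i 1) g z + (q.1 i : ℂ) * g z) U := by
  intro z hz
  have h1 : HasFDerivAt (auxAff d q)
      (∑ j, (q.1 j : ℂ) • (ContinuousLinearMap.proj j : (Fin d → ℂ) →L[ℂ] ℂ)) z := by
    unfold auxAff
    refine HasFDerivAt.add_const _ (HasFDerivAt.fun_sum fun j _ => ?_)
    exact (ContinuousLinearMap.proj (R := ℂ) (φ := fun _ : Fin d => ℂ) j).hasFDerivAt.const_mul _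
  have h2 := (hg.differentiableAt (hU.mem_nhds hz)).hasFDerivAt
  have h3 := (h1.mul h2).fderiv
  simp only [dirDeriv]
  have h4 : fderiv ℂ (fun z => auxAff d q z * g z) z = _ := h3
  rw [h4]
  have : ∑ j, (q.1 j : ℂ) * (((Pi.single i 1 : Fin d → ℝ) j : ℝ) : ℂ) = q.1 i := by
    rw [Finset.sum_eq_single i] <;> simp +contextual
  simp [this]
  ring

theorem aux_ddp_aff (hU : IsOpen U) (q : (Fin d → ℝ) × ℝ) (i : Fin d) (n : ℕ)
    {g : (Fin d → ℂ) → ℂ} (hg : DifferentiableOn ℂ g U) :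
    Set.EqOn (dirDerivPow d (Pi.single i 1) n (fun z => auxAff d q z * g z))
      (fun z => auxAff d q z * dirDerivPow d (Pi.single i 1) n g z +
        ((n : ℂ) * q.1 i) * dirDerivPow d (Pi.single i 1) (n - 1) g z) U := by
  induction n with
  | zero => intro z _; simp [dirDerivPow]
  | succ n ih =>
    have hn := aux_ddp_diff hU (Pi.single i 1) n hg
    refine (aux_dd_congr hU _ ih).trans ?_
    refine (aux_dd_add hU _ ((aux_aff_diff q).differentiableOn.fun_mul hn)
      ((aux_ddp_diff hU (Pi.single i 1) (n-1) hg).const_mul _)).trans ?_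
    intro z hz
    simp only
    rw [aux_dd_aff hU q i hn hz, aux_dd_smul hU _ _ (aux_ddp_diff hU (Pi.single i 1) (n-1) hg) hz]
    rcases n with _ | n
    · simp [dirDerivPow]
    · simp [dirDerivPow]
      ring

/-- Partial multi-index derivative along a list. -/
def auxMD (d : ℕ) (l : List (Fin d)) (γ : Fin d →₀ ℕ) (g : (Fin d → ℂ) → ℂ) :
    (Fin d → ℂ) → ℂ :=
  l.foldr (fun j h => dirDerivPow d (Pi.single j 1) (γ j) h) g

theorem aux_md_diff (hU : IsOpen U) (l : List (Fin d)) (γ : Fin d →₀ ℕ) {g : (Fin d → ℂ) → ℂ}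
    (hg : DifferentiableOn ℂ g U) : DifferentiableOn ℂ (auxMD d l γ g) U := by
  induction l with
  | nil => exact hg
  | cons i l ih => exact aux_ddp_diff hU _ _ ih

theorem aux_md_congr (l : List (Fin d)) {γ δ : Fin d →₀ ℕ} (h : ∀ j ∈ l, γ j = δ j)
    (g : (Fin d → ℂ) → ℂ) : auxMD d l γ g = auxMD d l δ g := by
  induction l with
  | nil => rfl
  | cons i l ih =>
    have h1 := ih (fun j hj => h j (List.mem_cons_of_mem _ hj))
    have h2 := h i List.mem_cons_self
    simp only [auxMD, List.foldr_cons] at *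
    rw [h1, h2]

theorem aux_md_aff (hU : IsOpen U) (q : (Fin d → ℝ) × ℝ) (l : List (Fin d)) (hl : l.Nodup)
    (γ : Fin d →₀ ℕ) {g : (Fin d → ℂ) → ℂ} (hg : DifferentiableOn ℂ g U) :
    Set.EqOn (auxMD d l γ (fun z => auxAff d q z * g z))
      (fun z => auxAff d q z * auxMD d l γ g z +
        (l.map (fun j => ((γ j : ℂ) * q.1 j) * auxMD d l (γ - Finsupp.single j 1) g z)).sum) U := by
  induction l with
  | nil => intro z _; simp [auxMD]
  | cons i l ih =>
    rw [List.nodup_cons] at hl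
    have hA : ∀ δ, DifferentiableOn ℂ (auxMD d l δ g) U := fun δ => aux_md_diff hU l δ hg
    refine (aux_ddp_congr hU _ _ (ih hl.2)).trans ?_
    refine (aux_ddp_add hU _ _ ((aux_aff_diff q).differentiableOn.fun_mul (hA γ))
      (aux_sum_diff l _ (fun j => (hA (γ - Finsupp.single j 1)).const_mul _))).trans ?_
    intro z hz
    simp only
    rw [aux_ddp_aff hU q i (γ i) (hA γ) hz,
      aux_ddp_sum hU _ _ l _ (fun j => auxMD d l (γ - Finsupp.single j 1) g) (fun j => hA _) hz]
    simp only [List.map_cons, List.sum_cons]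
    have e1 : auxMD d l γ g = auxMD d l (γ - Finsupp.single i 1) g := by
      apply aux_md_congr
      intro j hj
      have : i ≠ j := fun h => hl.1 (h ▸ hj)
      simp [Finsupp.single_apply, this]
    have e2 : auxMD d (i :: l) (γ - Finsupp.single i 1) g =
        dirDerivPow d (Pi.single i 1) (γ i - 1) (auxMD d l γ g) := by
      rw [e1]
      simp [auxMD]
    have e3 : l.map (fun j => ((γ j : ℂ) * q.1 j) *
          auxMD d (i :: l) (γ - Finsupp.single j 1) g z) =
        l.map (fun j => ((γ j : ℂ) * q.1 j) * dirDerivPow d (Pi.single i 1) (γ i)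
          (auxMD d l (γ - Finsupp.single j 1) g) z) := by
      apply List.map_congr_left
      intro j hj
      have : j ≠ i := fun h => hl.1 (h ▸ hj)
      simp [auxMD, Finsupp.single_apply, this]
    rw [e2, e3]
    change _ = auxAff d q z * dirDerivPow d (Pi.single i 1) (γ i) (auxMD d l γ g) z + _
    ring

theorem aux_multi_aff (hU : IsOpen U) (q : (Fin d → ℝ) × ℝ)
    (γ : Fin d →₀ ℕ) {g : (Fin d → ℂ) → ℂ} (hg : DifferentiableOn ℂ g U) (h0 : 0 ∈ U) :
    multiDeriv d γ (fun z => auxAff d q z * g z) 0 = q.2 * multiDeriv d γ g 0 +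
        ∑ j, ((γ j : ℂ) * q.1 j) * multiDeriv d (γ - Finsupp.single j 1) g 0 := by
  have := aux_md_aff hU q (List.finRange d) (List.nodup_finRange d) γ hg h0
  simp only at this
  rw [← Fin.sum_univ_def] at this
  have h2 : auxAff d q 0 = q.2 := by simp [auxAff]
  rw [h2] at this
  exact this

/-- Linear-map version of evaluation of an operator at zero. -/
def auxEv (d : ℕ) (g : (Fin d → ℂ) → ℂ) : MvPolynomial (Fin d) ℝ →ₗ[ℝ] ℂ :=
  Finsupp.lsum ℝ (fun γ => (LinearMap.toSpanSingleton ℝ ℂ (multiDeriv d γ g 0)))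
    ∘ₗ (AddMonoidAlgebra.coeffLinearEquiv ℝ).toLinearMap

theorem aux_ev_monomial (g : (Fin d → ℂ) → ℂ) (γ : Fin d →₀ ℕ) (a : ℝ) :
    auxEv d g (MvPolynomial.monomial γ a) = a * multiDeriv d γ g 0 := by
  have h : AddMonoidAlgebra.coeff (MvPolynomial.monomial γ a) = Finsupp.single γ a := rfl
  simp only [auxEv, LinearMap.comp_apply, LinearEquiv.coe_coe]
  change Finsupp.lsum ℝ (fun γ => (LinearMap.toSpanSingleton ℝ ℂ (multiDeriv d γ g 0)))
    (AddMonoidAlgebra.coeff (MvPolynomial.monomial γ a)) = _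
  rw [h]
  simp

theorem aux_ev_eq (g : (Fin d → ℂ) → ℂ) (u : MvPolynomial (Fin d) ℝ) :
    applyOp d u g 0 = auxEv d g u := by
  conv_rhs => rw [u.as_sum]
  rw [map_sum]
  simp only [aux_ev_monomial]
  rfl

/-- The derivation along a vector. -/
def auxD (d : ℕ) (ξ : Fin d → ℝ) :
    Derivation ℝ (MvPolynomial (Fin d) ℝ) (MvPolynomial (Fin d) ℝ) :=
  ∑ j, ξ j • MvPolynomial.pderiv j

theorem aux_D_apply (ξ : Fin d → ℝ) (u : MvPolynomial (Fin d) ℝ) :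
    auxD d ξ u = ∑ j, ξ j • MvPolynomial.pderiv j u := by
  have := map_sum (Derivation.coeFnAddMonoidHom (R := ℝ) (A := MvPolynomial (Fin d) ℝ)
    (M := MvPolynomial (Fin d) ℝ)) (fun j => ξ j • MvPolynomial.pderiv j) Finset.univ
  have h2 := congrFun this u
  rw [Finset.sum_apply] at h2
  exact h2

theorem aux_transpose (hU : IsOpen U) (q : (Fin d → ℝ) × ℝ)
    {g : (Fin d → ℂ) → ℂ} (hg : DifferentiableOn ℂ g U) (h0 : 0 ∈ U)
    (u : MvPolynomial (Fin d) ℝ) :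
    auxEv d (fun z => auxAff d q z * g z) u = auxEv d g (q.2 • u + auxD d q.1 u) := by
  induction u using MvPolynomial.induction_on' with
  | add p r hp hr => simp only [map_add, smul_add, hp, hr]; ring
  | monomial γ a =>
    have hD : auxD d q.1 (MvPolynomial.monomial γ a) =
        ∑ j, q.1 j • MvPolynomial.monomial (γ - Finsupp.single j 1) (a * γ j) := by
      simp only [aux_D_apply, MvPolynomial.pderiv_monomial]
    rw [hD]
    simp only [map_add, map_sum, map_smul, aux_ev_monomial, aux_multi_aff hU q γ hg h0]
    simp only [mul_add, Finset.mul_sum, Complex.real_smul]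
    congr 1
    · ring
    · refine Finset.sum_congr rfl fun j _ => ?_
      push_cast
      ring

theorem aux_D_X (ξ : Fin d → ℝ) (k : Fin d) : auxD d ξ (MvPolynomial.X k) = MvPolynomial.C (ξ k) := by
  simp only [aux_D_apply, MvPolynomial.pderiv_X]
  rw [Finset.sum_eq_single k]
  · simp [MvPolynomial.smul_eq_C_mul]
  · intro j _ hj
    simp [Pi.single_apply, hj, hj.symm]
  · simp

theorem aux_nil (ξ : Fin d → ℝ) (u : MvPolynomial (Fin d) ℝ) :
    ∃ n, ((auxD d ξ).toLinearMap ^ n) u = 0 := by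
  induction u using MvPolynomial.induction_on with
  | C a => exact ⟨1, by simpa using (auxD d ξ).map_algebraMap a⟩
  | add p r hp hr =>
    obtain ⟨n, hn⟩ := hp
    obtain ⟨m, hm⟩ := hr
    refine ⟨n + m, ?_⟩
    rw [map_add]
    nth_rewrite 1 [add_comm n m]
    rw [pow_add, pow_add, Module.End.mul_apply, Module.End.mul_apply, hn, hm]
    simp
  | mul_X p i hp =>
    obtain ⟨n, hn⟩ := hp
    have key : ∀ m : ℕ, ((auxD d ξ).toLinearMap ^ (m+1)) (p * MvPolynomial.X i) =
        ((auxD d ξ).toLinearMap ^ (m+1)) p * MvPolynomial.X i +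
        ((m + 1 : ℝ) * ξ i) • ((auxD d ξ).toLinearMap ^ m) p := by
      intro m
      induction m with
      | zero =>
        simp [Derivation.leibniz, aux_D_X, MvPolynomial.smul_eq_C_mul]
        ring
      | succ m ih =>
        rw [pow_succ' _ (m+1), Module.End.mul_apply, ih, Module.End.mul_apply, map_add, map_smul]
        rw [pow_succ' _ m, Module.End.mul_apply]
        simp only [Derivation.coeFn_coe, Derivation.leibniz, aux_D_X,
          MvPolynomial.smul_eq_C_mul, smul_eq_mul]
        push_cast
        simp only [map_mul, map_add, map_one]
        ring
    refine ⟨n + 1, ?_⟩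
    rw [key, pow_succ', Module.End.mul_apply, hn]
    simp

theorem aux_surj (q : (Fin d → ℝ) × ℝ) (hq : q.1 ≠ 0) (u : MvPolynomial (Fin d) ℝ) :
    ∃ w, q.2 • w + auxD d q.1 w = u := by
  obtain ⟨n, hn⟩ := aux_nil q.1 u
  by_cases hc : q.2 = 0
  · obtain ⟨k, hk⟩ := Function.ne_iff.mp hq
    have hk : q.1 k ≠ 0 := hk
    have main : ∀ n, ∀ u, ((auxD d q.1).toLinearMap ^ n) u = 0 → ∀ m : ℕ,
        ∃ w, auxD d q.1 w = MvPolynomial.X k ^ m * u := by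
      intro n
      induction n with
      | zero => intro u hu m; exact ⟨0, by simp at hu; simp [hu]⟩
      | succ n ih =>
        intro u hu m
        rw [pow_succ, Module.End.mul_apply] at hu
        obtain ⟨w, hw⟩ := ih _ hu (m + 1)
        have hne : ((m + 1 : ℝ) * q.1 k) ≠ 0 := mul_ne_zero (by positivity) hk
        refine ⟨((m + 1 : ℝ) * q.1 k)⁻¹ • (MvPolynomial.X k ^ (m+1) * u - w), ?_⟩
        rw [Derivation.map_smul, map_sub, hw, inv_smul_eq_iff₀ hne]
        simp only [Derivation.leibniz, Derivation.leibniz_pow, aux_D_X, smul_eq_mul,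
          MvPolynomial.smul_eq_C_mul, Derivation.coeFn_coe,
          nsmul_eq_mul, add_tsub_cancel_right, map_mul, map_add, map_one, map_natCast]
        push_cast
        ring
    obtain ⟨w, hw⟩ := main n u hn 0
    exact ⟨w, by simpa [hc] using hw⟩
  · have main : ∀ n, ∀ u, ((auxD d q.1).toLinearMap ^ n) u = 0 →
        ∃ w, q.2 • w + auxD d q.1 w = u := by
      intro n
      induction n with
      | zero => intro u hu; exact ⟨0, by simp at hu; simp [hu]⟩
      | succ n ih =>
        intro u hu
        rw [pow_succ, Module.End.mul_apply] at hu
        obtain ⟨w, hw⟩ := ih _ hu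
        refine ⟨q.2⁻¹ • (u - w), ?_⟩
        rw [Derivation.map_smul, ← smul_comm, ← smul_add, inv_smul_eq_iff₀ hc, map_sub, smul_sub]
        have hw' : q.2 • w + auxD d q.1 w = auxD d q.1 u := hw
        rw [← hw']
        abel
    exact main n u hn

end Helpers

/-- Lemma 10.5 of van den Ban–Schlichtkrull. -/
theorem exists_transposed_operator
    (d : ℕ) (hd : 1 ≤ d) (p : (Fin d → ℂ) → ℂ) (hp : IsPiR d p)
    (u : MvPolynomial (Fin d) ℝ) :
    ∃ u' : MvPolynomial (Fin d) ℝ,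
      ∀ φ : (Fin d → ℂ) → ℂ,
        (∃ U : Set (Fin d → ℂ), IsOpen U ∧ (0 : Fin d → ℂ) ∈ U ∧
          DifferentiableOn ℂ φ U) →
        applyOp d u' (fun z => p z * φ z) 0 = applyOp d u φ 0 := by
  obtain ⟨L, hL, rfl⟩ := hp
  simp only [aux_ev_eq]
  clear hd
  induction L generalizing u with
  | nil => exact ⟨u, fun φ _ => by simp⟩
  | cons q L ih =>
    obtain ⟨u₁, hu₁⟩ := ih u (fun r hr => hL r (List.mem_cons_of_mem _ hr))
    obtain ⟨w, hw⟩ := aux_surj q (hL q List.mem_cons_self) u₁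
    refine ⟨w, fun φ hφ => ?_⟩
    rw [← hu₁ φ hφ, ← hw]
    obtain ⟨U, hU, h0, hd⟩ := hφ
    have hprod : Differentiable ℂ (fun z : Fin d → ℂ =>
        (L.map (fun q => (∑ j, (q.1 j : ℂ) * z j) + (q.2 : ℂ))).prod) := by
      clear hL ih hu₁
      induction L with
      | nil => simp
      | cons r L ihL =>
        simp only [List.map_cons, List.prod_cons]
        exact (aux_aff_diff r).mul ihL
    rw [← aux_transpose hU q (hprod.differentiableOn.fun_mul hd) h0]
    simp only [List.map_cons, List.prod_cons, mul_assoc]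
    rfl
end
end
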